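/- In the setting of the multi-graded ring π_*(S) built from invertible objects X_1,...,X_n via canonical coherence isomorphisms, the twist element τ_{a,b} := D(T_{a,b}) — where T_{a,b} is the conjugate by canonical isomorphisms of the symmetry t_{a,b} : X^a ⊗ X^b → X^b ⊗ X^a — satisfies τ_{a,b} = τ_1^{a_1 b_1} ⋯ τ_n^{a_n b_n}, where τ_i = tr(id_{X_i}) are the basic commuters. -/

import Mathlib

open CategoryTheory MonoidalCategory

variable {C : Type*} [Category C] [MonoidalCategory C] [SymmetricCategory C]

/-- Left dual data for `X`. -/
structure LeftDualData (X : C) where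
  Y : C
  α : 𝟙_ C ⟶ Y ⊗ X
  αhat : X ⊗ Y ⟶ 𝟙_ C
  triangle₁ : (ρ_ X).inv ≫ (X ◁ α) ≫ (α_ X Y X).inv ≫ (αhat ▷ X) ≫ (λ_ X).hom = 𝟙 X
  triangle₂ : (λ_ Y).inv ≫ (α ▷ Y) ≫ (α_ Y X Y).hom ≫ (Y ◁ αhat) ≫ (ρ_ Y).hom = 𝟙 Y

/-- The trace of `f : X ⟶ X` with respect to a left dual of `X`. -/
def trOf {X : C} (D : LeftDualData X) (f : X ⟶ X) : 𝟙_ C ⟶ 𝟙_ C :=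
  D.α ≫ (D.Y ◁ f) ≫ (β_ D.Y X).hom ≫ D.αhat

/-- The `D`-invariant of `g : W ⟶ W` with respect to a chosen inverse `(V, δ)` of `W`. -/
def Dinv {W V : C} (δ : 𝟙_ C ≅ V ⊗ W) (g : W ⟶ W) : 𝟙_ C ⟶ 𝟙_ C :=
  δ.hom ≫ (V ◁ g) ≫ δ.inv

/-- Powers in the endomorphism monoid of the unit object. -/
def unitEndPow (τ : CategoryTheory.End (𝟙_ C)) (m : ℕ) : CategoryTheory.End (𝟙_ C) := τ ^ m

set_option linter.unusedSectionVars false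

open Functor.LaxMonoidal

/-- The action of an endomorphism of the unit object on an object `A`. -/
def unitScalar (c : 𝟙_ C ⟶ 𝟙_ C) (A : C) : A ⟶ A :=
  (λ_ A).inv ≫ c ▷ A ≫ (λ_ A).hom

lemma unitScalar_naturality (c : 𝟙_ C ⟶ 𝟙_ C) {A B : C} (f : A ⟶ B) :
    f ≫ unitScalar c B = unitScalar c A ≫ f := by
  rw [unitScalar, unitScalar, leftUnitor_inv_naturality_assoc, whisker_exchange_assoc]
  simp

lemma unitScalar_naturality_assoc (c : 𝟙_ C ⟶ 𝟙_ C) {A B Z : C} (f : A ⟶ B) (h : B ⟶ Z) :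
    f ≫ unitScalar c B ≫ h = unitScalar c A ≫ f ≫ h := by
  rw [← Category.assoc, unitScalar_naturality, Category.assoc]

lemma unitScalar_comp (c d : 𝟙_ C ⟶ 𝟙_ C) (A : C) :
    unitScalar (c ≫ d) A = unitScalar c A ≫ unitScalar d A := by
  simp [unitScalar]

@[simp]
lemma unitScalar_id (A : C) : unitScalar (𝟙 (𝟙_ C)) A = 𝟙 A := by
  simp [unitScalar]

@[simp]
lemma unitScalar_unit (c : 𝟙_ C ⟶ 𝟙_ C) : unitScalar c (𝟙_ C) = c := by
  rw [unitScalar, unitors_equal, rightUnitor_naturality, ← unitors_equal, Iso.inv_hom_id_assoc]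

lemma unitScalar_whiskerRight (c : 𝟙_ C ⟶ 𝟙_ C) (A B : C) :
    unitScalar c A ▷ B = unitScalar c (A ⊗ B) := by
  simp [unitScalar]

lemma whiskerLeft_unitScalar (c : 𝟙_ C ⟶ 𝟙_ C) (A B : C) :
    A ◁ unitScalar c B = unitScalar c (A ⊗ B) := by
  rw [← cancel_mono (β_ A B).hom, BraidedCategory.braiding_naturality_right,
    unitScalar_whiskerRight, unitScalar_naturality]

lemma unit_comp_comm (c d : 𝟙_ C ⟶ 𝟙_ C) : c ≫ d = d ≫ c := by
  simpa using unitScalar_naturality d c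

lemma Dinv_unitScalar {W V : C} (δ : 𝟙_ C ≅ V ⊗ W) (c : 𝟙_ C ⟶ 𝟙_ C) :
    Dinv δ (unitScalar c W) = c := by
  simp [Dinv, whiskerLeft_unitScalar, unitScalar_naturality_assoc]

lemma unitScalar_injective {W V : C} (δ : 𝟙_ C ≅ V ⊗ W) {c d : 𝟙_ C ⟶ 𝟙_ C}
    (h : unitScalar c W = unitScalar d W) : c = d := by
  rw [← Dinv_unitScalar δ c, h, Dinv_unitScalar]

/-- The functor `- ⊗ X` is an equivalence when `X` has an inverse `Y`. -/
def tensorRightEquivalence {X Y : C} (α : 𝟙_ C ≅ Y ⊗ X) : C ≌ C :=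
  CategoryTheory.Equivalence.mk (tensorRight X) (tensorRight Y)
    ((rightUnitorNatIso C).symm ≪≫ (tensoringRight C).mapIso (α ≪≫ β_ Y X) ≪≫
      tensorRightTensor X Y)
    ((tensorRightTensor Y X).symm ≪≫ (tensoringRight C).mapIso α.symm ≪≫ rightUnitorNatIso C)

/-- Tensoring with an invertible object is fully faithful. -/
def tensorRightFullyFaithful {X Y : C} (α : 𝟙_ C ≅ Y ⊗ X) : (tensorRight X).FullyFaithful :=
  (tensorRightEquivalence α).fullyFaithfulFunctor

lemma whiskerRight_injective_of_iso {X Y : C} (α : 𝟙_ C ≅ Y ⊗ X) {A B : C} {f g : A ⟶ B}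
    (h : f ▷ X = g ▷ X) : f = g :=
  (tensorRightFullyFaithful α).map_injective h

lemma exists_eq_unitScalar {W V : C} (δ : 𝟙_ C ≅ V ⊗ W) (g : W ⟶ W) :
    ∃ c, g = unitScalar c W := by
  have δ' : 𝟙_ C ≅ W ⊗ V := δ ≪≫ β_ V W
  refine ⟨δ'.hom ≫ g ▷ V ≫ δ'.inv, whiskerRight_injective_of_iso δ' ?_⟩
  rw [unitScalar_whiskerRight, ← cancel_epi δ'.hom, unitScalar_naturality]
  simp

/-- The canonical braiding on a discrete additive commutative monoid. -/
instance discreteAddBraided (A : Type*) [AddCommMonoid A] : BraidedCategory (Discrete A) where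
  braiding a b := Discrete.eqToIso (add_comm a.as b.as)

lemma braiding_self_eq_trOf {X Y : C} (α : 𝟙_ C ≅ Y ⊗ X) (D : LeftDualData X) :
    (β_ X X).hom = unitScalar (trOf D (𝟙 X)) (X ⊗ X) ∧
      trOf D (𝟙 X) ≫ trOf D (𝟙 X) = 𝟙 (𝟙_ C) := by
  let δ : 𝟙_ C ≅ (Y ⊗ Y) ⊗ (X ⊗ X) :=
    α ≪≫ whiskerLeftIso Y ((λ_ X).symm ≪≫ whiskerRightIso α X ≪≫ α_ Y X X) ≪≫ (α_ _ _ _).symm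
  obtain ⟨c, hc⟩ := exists_eq_unitScalar δ (β_ X X).hom
  have hsq : c ≫ c = 𝟙 (𝟙_ C) := by
    refine unitScalar_injective δ ?_
    rw [unitScalar_comp, ← hc]
    simp
  have htr : c ≫ trOf D (𝟙 X) = 𝟙 (𝟙_ C) := by
    refine unitScalar_injective α ?_
    have key : D.α ▷ X ≫ (α_ D.Y X X).hom ≫ D.Y ◁ (β_ X X).hom ≫ (α_ D.Y X X).inv ≫
        (β_ D.Y X).hom ▷ X = (λ_ X).hom ≫ (ρ_ X).inv ≫ X ◁ D.α ≫ (α_ X D.Y X).inv := by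
      have h := BraidedCategory.braiding_naturality_right X D.α
      rw [BraidedCategory.braiding_tensor_right_hom, braiding_tensorUnit_right] at h
      have h' := (ρ_ X).inv ≫= h
      simp only [Category.assoc, Iso.inv_hom_id_assoc] at h'
      have h'' := (λ_ X).hom ≫= h' =≫ ((α_ D.Y X X).hom ≫ D.Y ◁ (β_ X X).hom ≫
        (α_ D.Y X X).inv ≫ (β_ D.Y X).hom ▷ X)
      simp only [Category.assoc, Iso.inv_hom_id_assoc, Iso.hom_inv_id_assoc] at h''
      rw [← h'']
      simp [← comp_whiskerRight, ← whiskerLeft_comp_assoc]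
    have h2 := (λ_ X).inv ≫= key =≫ (D.αhat ▷ X ≫ (λ_ X).hom)
    simp only [Category.assoc, Iso.inv_hom_id_assoc, D.triangle₁] at h2
    have htr : trOf D (𝟙 X) = D.α ≫ (β_ D.Y X).hom ≫ D.αhat := by simp [trOf]
    rw [unitScalar_id, htr, ← h2, hc, whiskerLeft_unitScalar,
      unitScalar_naturality_assoc _ (α_ _ _ _).hom,
      unitScalar_naturality_assoc _ (D.α ▷ X), unitScalar_naturality_assoc _ (λ_ X).inv,
      unitScalar_comp]
    congr 1
    simp only [unitScalar, comp_whiskerRight, Category.assoc, Iso.hom_inv_id_assoc]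
  have : trOf D (𝟙 X) = c := by
    rw [← Category.id_comp (trOf D (𝟙 X)), ← hsq, Category.assoc, htr, Category.comp_id]
  rw [this]
  exact ⟨hc, hsq⟩

section Twist

variable {D : Type*} [Category D] [MonoidalCategory D] [BraidedCategory D]

/-- A monoidal functor `F` is braided up to the scalars `χ`. -/
def IsTwistedBraided (F : D ⥤ C) [F.Monoidal] (χ : D → D → (𝟙_ C ⟶ 𝟙_ C)) : Prop :=
  ∀ a b, (β_ (F.obj a) (F.obj b)).hom ≫ μ F b a =
    unitScalar (χ a b) _ ≫ μ F a b ≫ F.map (β_ a b).hom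

lemma tensorμ_braiding (A B A' B' : C) :
    (β_ (A ⊗ B) (A' ⊗ B')).hom ≫ tensorμ A' B' A B =
      tensorμ A B A' B' ≫ ((β_ A A').hom ⊗ₘ (β_ B B').hom) := by
  calc
    _ = 𝟙 _ ⊗≫ A ◁ (β_ B A').hom ▷ B' ⊗≫ (A ⊗ A') ◁ (β_ B B').hom ⊗≫
        (β_ A A').hom ▷ (B' ⊗ B) ⊗≫
          A' ◁ ((β_ A B').hom ≫ (β_ B' A).hom) ▷ B ⊗≫ 𝟙 _ := by
      rw [tensorμ, BraidedCategory.braiding_tensor_left_hom,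
        BraidedCategory.braiding_tensor_right_hom, BraidedCategory.braiding_tensor_right_hom]
      monoidal
    _ = _ := by
      rw [SymmetricCategory.symmetry, tensorμ, MonoidalCategory.tensorHom_def']
      monoidal

lemma unitScalar_tensorHom_unitScalar (c d : 𝟙_ C ⟶ 𝟙_ C) (A B : C) :
    unitScalar c A ⊗ₘ unitScalar d B = unitScalar (c ≫ d) (A ⊗ B) := by
  rw [MonoidalCategory.tensorHom_def, unitScalar_whiskerRight, whiskerLeft_unitScalar,
    unitScalar_comp]

lemma IsTwistedBraided.tensor {F G : D ⥤ C} [F.Monoidal] [G.Monoidal]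
    {χ ψ : D → D → (𝟙_ C ⟶ 𝟙_ C)} (hF : IsTwistedBraided F χ) (hG : IsTwistedBraided G ψ) :
    IsTwistedBraided (F.prod' G ⋙ tensor C) (fun a b => χ a b ≫ ψ a b) := by
  intro a b
  have h := tensorμ_braiding (F.obj a) (G.obj a) (F.obj b) (G.obj b) =≫
    (μ F b a ⊗ₘ μ G b a)
  simp only [Category.assoc, tensorHom_comp_tensorHom, hF a b, hG a b] at h
  rw [← tensorHom_comp_tensorHom, unitScalar_tensorHom_unitScalar,
    unitScalar_naturality_assoc, ← tensorHom_comp_tensorHom] at h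
  simpa [Functor.LaxMonoidal.comp_μ] using h

lemma IsTwistedBraided.of_iso {F G : D ⥤ C} [F.Monoidal] {χ : D → D → (𝟙_ C ⟶ 𝟙_ C)}
    (hF : IsTwistedBraided F χ) (e : F ≅ G) :
    letI := Functor.Monoidal.transport e
    IsTwistedBraided G χ := by
  intro a b
  simp only [Functor.Monoidal.transport_μ]
  rw [← BraidedCategory.braiding_naturality_assoc, reassoc_of% (hF a b),
    unitScalar_naturality_assoc]
  simp

lemma IsTwistedBraided.comp {E : Type*} [Category E] [MonoidalCategory E] [BraidedCategory E]
    {F : D ⥤ C} [F.Monoidal] {χ : D → D → (𝟙_ C ⟶ 𝟙_ C)}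
    (hF : IsTwistedBraided F χ) (G : E ⥤ D) [G.Braided] :
    IsTwistedBraided (G ⋙ F) (fun a b => χ (G.obj a) (G.obj b)) := by
  intro a b
  have h := hF (G.obj a) (G.obj b) =≫ F.map (μ G b a)
  simp only [Functor.LaxMonoidal.comp_μ, Functor.comp_obj, Functor.comp_map, Category.assoc] at h ⊢
  rw [h, ← F.map_comp, ← F.map_comp, ← Functor.LaxBraided.braided]

lemma IsTwistedBraided.exists_of_iso {F : D ⥤ C} [F.Monoidal]
    (inv : ∀ a : D, ∃ a' : D, Nonempty (𝟙_ D ≅ a' ⊗ a)) :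
    ∃ χ, IsTwistedBraided F χ := by
  have (a b : D) : ∃ c, (β_ (F.obj a) (F.obj b)).hom ≫ μ F b a =
      unitScalar c _ ≫ μ F a b ≫ F.map (β_ a b).hom := by
    obtain ⟨W, ⟨w⟩⟩ := inv (a ⊗ b)
    let e : F.obj a ⊗ F.obj b ≅ F.obj b ⊗ F.obj a :=
      Functor.Monoidal.μIso F a b ≪≫ F.mapIso (β_ a b) ≪≫ (Functor.Monoidal.μIso F b a).symm
    let δ : 𝟙_ C ≅ F.obj W ⊗ (F.obj a ⊗ F.obj b) := Functor.Monoidal.εIso F ≪≫ F.mapIso w ≪≫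
      (Functor.Monoidal.μIso F _ _).symm ≪≫
        whiskerLeftIso _ (Functor.Monoidal.μIso F a b).symm
    obtain ⟨c, hc⟩ := exists_eq_unitScalar δ ((β_ (F.obj a) (F.obj b)).hom ≫ e.inv)
    refine ⟨c, ?_⟩
    rw [← hc]
    simp [e]
  choose χ hχ using this
  exact ⟨χ, hχ⟩

lemma IsTwistedBraided.tensor_right {F : D ⥤ C} [F.Monoidal] {χ : D → D → (𝟙_ C ⟶ 𝟙_ C)}
    (hF : IsTwistedBraided F χ) (a b c : D) :
    unitScalar (χ a (b ⊗ c)) (F.obj a ⊗ F.obj b ⊗ F.obj c) =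
      unitScalar (χ a b ≫ χ a c) _ := by
  rw [← cancel_mono (F.obj a ◁ μ F b c ≫ μ F a (b ⊗ c) ≫ F.map (β_ a (b ⊗ c)).hom),
    ← unitScalar_naturality_assoc, ← hF, BraidedCategory.braiding_naturality_right_assoc,
    BraidedCategory.braiding_tensor_right_hom]
  have assoc_bca : (α_ (F.obj b) (F.obj c) (F.obj a)).inv ≫ μ F b c ▷ F.obj a ≫ μ F (b ⊗ c) a =
      F.obj b ◁ μ F c a ≫ μ F b (c ⊗ a) ≫ F.map (α_ b c a).inv := by
    simp
  have assoc_bac : (α_ (F.obj b) (F.obj a) (F.obj c)).hom ≫ F.obj b ◁ μ F a c ≫ μ F b (a ⊗ c) =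
      μ F b a ▷ F.obj c ≫ μ F (b ⊗ a) c ≫ F.map (α_ b a c).hom := by
    simp
  have assoc_abc : (α_ (F.obj a) (F.obj b) (F.obj c)).inv ≫ μ F a b ▷ F.obj c ≫ μ F (a ⊗ b) c =
      F.obj a ◁ μ F b c ≫ μ F a (b ⊗ c) ≫ F.map (α_ a b c).inv := by
    simp
  have h_ac := congrArg (F.obj b ◁ ·) (hF a c)
  have h_ab := congrArg (· ▷ F.obj c) (hF a b)
  simp only [MonoidalCategory.whiskerLeft_comp, comp_whiskerRight, whiskerLeft_unitScalar,
    unitScalar_whiskerRight] at h_ac h_ab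
  simp only [Category.assoc]
  rw [assoc_bca, reassoc_of% h_ac, μ_natural_right_assoc, unitScalar_naturality_assoc,
    unitScalar_naturality_assoc, unitScalar_naturality_assoc,
    reassoc_of% assoc_bac, reassoc_of% h_ab, unitScalar_naturality_assoc, μ_natural_left_assoc,
    reassoc_of% assoc_abc, unit_comp_comm, unitScalar_comp, Category.assoc]
  simp only [← F.map_comp, BraidedCategory.braiding_tensor_right_hom]

lemma IsTwistedBraided.comp_swap {F : D ⥤ C} [F.Monoidal] {χ : D → D → (𝟙_ C ⟶ 𝟙_ C)}
    (hF : IsTwistedBraided F χ) (a b : D) (h : (β_ a b).hom ≫ (β_ b a).hom = 𝟙 (a ⊗ b)) :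
    unitScalar (χ a b ≫ χ b a) (F.obj a ⊗ F.obj b) = 𝟙 _ := by
  rw [← cancel_mono (μ F a b), unit_comp_comm, unitScalar_comp, Category.assoc]
  have h1 := hF a b =≫ F.map (β_ b a).hom
  simp only [Category.assoc, ← F.map_comp, h, F.map_id, Category.comp_id] at h1
  rw [← h1, ← unitScalar_naturality_assoc, ← hF]
  simp

end Twist

lemma map_int_eq_pow_natAbs {M : Type*} [Monoid M] (f : ℤ → M)
    (hadd : ∀ x y, f (x + y) = f x * f y) (h0 : f 0 = 1) (h1 : f 1 * f 1 = 1) (k : ℤ) :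
    f k = f 1 ^ k.natAbs := by
  have hnat (m : ℕ) : f m = f 1 ^ m := by
    induction m with
    | zero => simpa using h0
    | succ m ih => rw [Nat.cast_succ, hadd, ih, pow_succ]
  obtain h | h := k.natAbs_eq
  · rw [h, hnat, Int.natAbs_natCast]
  · have hinv : f 1 ^ k.natAbs * f 1 ^ k.natAbs = 1 := by
      rw [← pow_add, ← two_mul, pow_mul, pow_two, h1, one_pow]
    have hk : f k * f 1 ^ k.natAbs = 1 := by
      rw [← hnat, ← hadd, ← h0]
      congr 1
      lia
    rw [← mul_one (f k), ← hinv, ← mul_assoc, hk, one_mul]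

/-- A monoidal functor out of the discrete category of integers is braided up to powers of the
scalar by which the image of the generator braids with itself. -/
lemma isTwistedBraided_int (F : Discrete ℤ ⥤ C) [F.Monoidal] (τ : End (𝟙_ C))
    (hτ : (β_ (F.obj ⟨1⟩) (F.obj ⟨1⟩)).hom = unitScalar τ _) (hsq : τ * τ = 1) :
    IsTwistedBraided F (fun a b => unitEndPow τ (a.as * b.as).natAbs) := by
  obtain ⟨χ, hχ⟩ := IsTwistedBraided.exists_of_iso (F := F)
    (fun a => ⟨⟨-a.as⟩, ⟨Discrete.eqToIso (neg_add_cancel a.as).symm⟩⟩)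
  let inv (a : Discrete ℤ) : 𝟙_ C ≅ F.obj ⟨-a.as⟩ ⊗ F.obj a :=
    Functor.Monoidal.εIso F ≪≫ F.mapIso (Discrete.eqToIso (neg_add_cancel a.as).symm) ≪≫
      (Functor.Monoidal.μIso F _ _).symm
  have inj2 {c d : 𝟙_ C ⟶ 𝟙_ C} (a b : Discrete ℤ)
      (h : unitScalar c (F.obj a ⊗ F.obj b) = unitScalar d (F.obj a ⊗ F.obj b)) : c = d := by
    refine unitScalar_injective (inv (a ⊗ b)) ?_
    rw [← cancel_epi (μ F a b), unitScalar_naturality, unitScalar_naturality, h]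
  have inj3 {c d : 𝟙_ C ⟶ 𝟙_ C} (a b e : Discrete ℤ)
      (h : unitScalar c (F.obj a ⊗ F.obj b ⊗ F.obj e) =
        unitScalar d (F.obj a ⊗ F.obj b ⊗ F.obj e)) : c = d := by
    refine inj2 a (b ⊗ e) ?_
    rw [← cancel_epi (F.obj a ◁ μ F b e), unitScalar_naturality, unitScalar_naturality, h]
  let f (a b : ℤ) : End (𝟙_ C) := χ ⟨a⟩ ⟨b⟩
  have hadd (a b c : ℤ) : f a (b + c) = f a b * f a c :=
    (inj3 _ _ _ (hχ.tensor_right ⟨a⟩ ⟨b⟩ ⟨c⟩)).trans (unit_comp_comm _ _)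
  have hswap (a b : ℤ) : f a b * f b a = 1 :=
    inj2 _ _ ((hχ.comp_swap ⟨b⟩ ⟨a⟩ (Subsingleton.elim _ _)).trans (unitScalar_id _).symm)
  have hzero (a : ℤ) : f a 0 = 1 := by
    have h : f a 0 = f a 0 * f a 0 := by rw [← hadd, add_zero]
    rw [← mul_one (f a 0), ← hswap a 0, ← mul_assoc, ← h]
  have hone : f 1 1 = τ := by
    refine inj2 _ _ ((cancel_mono (μ F ⟨1⟩ ⟨1⟩)).1 ?_)
    have h := hχ ⟨1⟩ ⟨1⟩
    rw [show (β_ (⟨1⟩ : Discrete ℤ) ⟨1⟩).hom = 𝟙 _ from Subsingleton.elim _ _, F.map_id,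
      Category.comp_id, hτ] at h
    exact h.symm
  have hpow (m : ℕ) : τ ^ m * τ ^ m = 1 := by
    rw [← pow_add, ← two_mul, pow_mul, pow_two, hsq, one_pow]
  have hleft (a : ℤ) : f 1 a = τ ^ a.natAbs := by
    rw [map_int_eq_pow_natAbs (f 1) (hadd 1) (hzero 1) (by rw [hone, hsq]), hone]
  have hright (a : ℤ) : f a 1 = τ ^ a.natAbs := by
    rw [← mul_one (f a 1), ← hpow a.natAbs, ← mul_assoc, ← hleft, hswap, one_mul]
  have hχ' : χ = fun a b => unitEndPow τ (a.as * b.as).natAbs := by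
    funext a b
    have := map_int_eq_pow_natAbs (f a.as) (hadd _) (hzero _) (by rw [hright, hpow]) b.as
    rwa [hright, ← pow_mul, ← Int.natAbs_mul] at this
  exact hχ' ▸ hχ

lemma exists_int_family {T : ℤ → Type*} (E : ∀ k, T k ≃ T (k + 1)) (t : T 0) :
    ∃ f : ∀ k, T k, f 0 = t ∧ ∀ k, f (k + 1) = E k (f k) := by
  let up (m : ℕ) : T m := Nat.rec t (fun m x => E m x) m
  let down (m : ℕ) : T (Int.negSucc m) :=
    Nat.rec ((E (Int.negSucc 0)).symm t) (fun m x => (E (Int.negSucc (m + 1))).symm x) m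
  refine ⟨fun k => match k with
    | Int.ofNat m => up m
    | Int.negSucc m => down m, rfl, fun k => ?_⟩
  match k with
  | Int.ofNat m => rfl
  | Int.negSucc 0 => exact ((E (Int.negSucc 0)).apply_symm_apply t).symm
  | Int.negSucc (m + 1) => exact ((E (Int.negSucc (m + 1))).apply_symm_apply (down m)).symm

/-- Integral tensor powers of `X`, where `Y` serves as the inverse of `X`. -/
def intPow (X Y : C) : ℤ → C
  | Int.ofNat m => Nat.rec (𝟙_ C) (fun _ Z => Z ⊗ X) m
  | Int.negSucc m => Nat.rec Y (fun _ Z => Z ⊗ Y) m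

lemma nonempty_intPow_tensor_iso {X Y : C} (α : 𝟙_ C ≅ Y ⊗ X) (k : ℤ) :
    Nonempty (intPow X Y k ⊗ X ≅ intPow X Y (k + 1)) :=
  match k with
  | Int.ofNat _ => ⟨Iso.refl _⟩
  | Int.negSucc 0 => ⟨α.symm⟩
  | Int.negSucc (m + 1) =>
    ⟨α_ (intPow X Y (Int.negSucc m)) Y X ≪≫ whiskerLeftIso _ α.symm ≪≫ ρ_ _⟩

section Sequences

variable {X Y : C} {P Q : ℤ → C}

lemma exists_iso_of_steps (α : 𝟙_ C ≅ Y ⊗ X) (s : ∀ k, P k ⊗ X ≅ P (k + 1))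
    (t : ∀ k, Q k ⊗ X ≅ Q (k + 1))
    (e : P 0 ≅ Q 0) : ∃ f : ∀ k, P k ≅ Q k, f 0 = e ∧
      ∀ k, (s k).hom ≫ (f (k + 1)).hom = (f k).hom ▷ X ≫ (t k).hom := by
  obtain ⟨f, h0, hf⟩ := exists_int_family (T := fun k => P k ≅ Q k)
    (fun k => (tensorRightFullyFaithful α).isoEquiv.trans (Iso.isoCongr (s k) (t k))) e
  refine ⟨f, h0, fun k => ?_⟩
  simp [hf, Functor.FullyFaithful.isoEquiv]

lemma hom_eq_of_steps (α : 𝟙_ C ≅ Y ⊗ X) (s : ∀ k, P k ⊗ X ≅ P (k + 1))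
    (t : ∀ k, Q k ⊗ X ≅ Q (k + 1))
    {f g : ∀ k, P k ⟶ Q k} (h0 : f 0 = g 0)
    (hf : ∀ k, (s k).hom ≫ f (k + 1) = f k ▷ X ≫ (t k).hom)
    (hg : ∀ k, (s k).hom ≫ g (k + 1) = g k ▷ X ≫ (t k).hom) (k : ℤ) : f k = g k := by
  have step (k : ℤ) : f k = g k ↔ f (k + 1) = g (k + 1) := by
    constructor
    · intro h
      rw [← cancel_epi (s k).hom, hf, hg, h]
    · intro h
      refine whiskerRight_injective_of_iso α ((cancel_mono (t k).hom).1 ?_)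
      rw [← hf, ← hg, h]
  induction k using Int.induction_on with
  | zero => exact h0
  | succ m ih => exact (step _).1 ih
  | pred m ih => exact (step _).2 (by rwa [sub_add_cancel])

lemma eqToHom_whiskerRight_step (s : ∀ k, P k ⊗ X ≅ P (k + 1)) {k l : ℤ} (h : k = l) :
    eqToHom (congrArg P h) ▷ X ≫ (s l).hom =
      (s k).hom ≫ eqToHom (congrArg (fun k => P (k + 1)) h) := by
  subst h
  simp

lemma discreteFunctor_map {I : Type*} (P : I → C) {a b : Discrete I} (f : a ⟶ b) :
    (Discrete.functor P).map f = eqToHom (congrArg P (Discrete.eq_of_hom f)) := by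
  obtain ⟨a⟩ := a
  obtain ⟨b⟩ := b
  obtain rfl : a = b := Discrete.eq_of_hom f
  rw [Subsingleton.elim f (𝟙 _)]
  simp

end Sequences

lemma exists_monoidal_int {X Y : C} (α : 𝟙_ C ≅ Y ⊗ X) :
    ∃ (F : Discrete ℤ ⥤ C) (_ : F.Monoidal), Nonempty (F.obj ⟨1⟩ ≅ X) := by
  have s (k : ℤ) := (nonempty_intPow_tensor_iso α k).some
  have u : 𝟙_ C ≅ intPow X Y 0 := Iso.refl _
  have e1 : intPow X Y 1 ≅ X := λ_ X
  generalize intPow X Y = P at s u e1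
  have hφ (a : ℤ) := exists_iso_of_steps α (P := fun k => P a ⊗ P k) (Q := fun k => P (a + k))
    (fun k => α_ _ _ _ ≪≫ whiskerLeftIso _ (s k))
    (fun k => s (a + k) ≪≫ eqToIso (congrArg P (add_assoc a k 1)))
    (whiskerLeftIso _ u.symm ≪≫ ρ_ _ ≪≫ eqToIso (congrArg P (add_zero a).symm))
  choose φ hφ0 hφ using hφ
  have hφ' (a k : ℤ) : P a ◁ (s k).hom ≫ (φ a (k + 1)).hom = (α_ _ _ _).inv ≫
      (φ a k).hom ▷ X ≫ (s (a + k)).hom ≫ eqToHom (congrArg P (add_assoc a k 1)) := by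
    rw [Iso.eq_inv_comp]
    simpa using hφ a k
  have φ_eq_left {a a' : ℤ} (h : a = a') (b : ℤ) : eqToHom (congrArg P h) ▷ P b ≫ (φ a' b).hom =
      (φ a b).hom ≫ eqToHom (congrArg (fun a => P (a + b)) h) := by
    subst h
    simp
  have φ_eq_right (a : ℤ) {b b' : ℤ} (h : b = b') : P a ◁ eqToHom (congrArg P h) ≫ (φ a b').hom =
      (φ a b).hom ≫ eqToHom (congrArg (fun b => P (a + b)) h) := by
    subst h
    simp
  have pentagon (a b c : ℤ) : (φ a b).hom ▷ P c ≫ (φ (a + b) c).hom ≫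
      eqToHom (congrArg P (add_assoc a b c)) =
        (α_ _ _ _).hom ≫ P a ◁ (φ b c).hom ≫ (φ a (b + c)).hom := by
    refine hom_eq_of_steps α (P := fun c => (P a ⊗ P b) ⊗ P c) (Q := fun c => P (a + (b + c)))
      (fun k => α_ _ _ _ ≪≫ whiskerLeftIso _ (s k))
      (fun k => s (a + (b + k)) ≪≫ eqToIso (congrArg P (by ring)))
      (f := fun c => (φ a b).hom ▷ P c ≫ (φ (a + b) c).hom ≫
        eqToHom (congrArg P (add_assoc a b c)))
      (g := fun c => (α_ _ _ _).hom ≫ P a ◁ (φ b c).hom ≫ (φ a (b + c)).hom) ?_ ?_ ?_ c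
    · have h := φ_eq_right a (add_zero b).symm
      simp only [hφ0, Iso.trans_hom, whiskerLeftIso_hom, Iso.symm_hom, eqToIso.hom,
        MonoidalCategory.whiskerLeft_comp, Category.assoc, h]
      rw [← whisker_exchange_assoc, rightUnitor_naturality_assoc, rightUnitor_tensor_hom_assoc]
      simp
    · intro k
      have h := eqToHom_whiskerRight_step s (add_assoc a b k)
      simp only [Iso.trans_hom, whiskerLeftIso_hom, eqToIso.hom, Category.assoc,
        comp_whiskerRight]
      rw [whisker_exchange_assoc, reassoc_of% hφ', reassoc_of% h]
      simp
    · intro k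
      have h := congrArg (P a ◁ ·) (hφ' b k)
      simp only [MonoidalCategory.whiskerLeft_comp] at h
      simp only [Iso.trans_hom, whiskerLeftIso_hom, eqToIso.hom, Category.assoc,
        comp_whiskerRight]
      rw [tensor_whiskerLeft_assoc, Iso.inv_hom_id_assoc, reassoc_of% h,
        φ_eq_right a (add_assoc b k 1), reassoc_of% (hφ' a (b + k))]
      simp
  have left_unit (b : ℤ) : (λ_ (P b)).hom = u.hom ▷ P b ≫ (φ 0 b).hom ≫
      eqToHom (congrArg P (zero_add b)) := by
    refine hom_eq_of_steps α (P := fun c => 𝟙_ C ⊗ P c) (Q := P)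
      (fun k => α_ _ _ _ ≪≫ whiskerLeftIso _ (s k)) s
      (f := fun b => (λ_ (P b)).hom) (g := fun b => u.hom ▷ P b ≫ (φ 0 b).hom ≫
        eqToHom (congrArg P (zero_add b))) ?_ ?_ ?_ b
    · simp only [hφ0, Iso.trans_hom, whiskerLeftIso_hom, Iso.symm_hom, eqToIso.hom,
        Category.assoc]
      rw [← whisker_exchange_assoc, rightUnitor_naturality_assoc, ← unitors_equal,
        leftUnitor_naturality_assoc]
      simp
    · intro k
      simp
    · intro k
      have h := eqToHom_whiskerRight_step s (zero_add k)
      simp only [Iso.trans_hom, whiskerLeftIso_hom, Category.assoc, comp_whiskerRight]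
      rw [whisker_exchange_assoc, reassoc_of% hφ', h]
      simp
  refine ⟨Discrete.functor P, Functor.CoreMonoidal.toMonoidal
    { εIso := u
      μIso := fun a b => φ a.as b.as
      μIso_hom_natural_left := ?_
      μIso_hom_natural_right := ?_
      associativity := ?_
      left_unitality := ?_
      right_unitality := ?_ }, ⟨e1⟩⟩
  · intro a a' f b
    simpa [discreteFunctor_map] using φ_eq_left (Discrete.eq_of_hom f) b.as
  · intro b b' a f
    simpa [discreteFunctor_map] using φ_eq_right a.as (Discrete.eq_of_hom f)
  · intro a b c
    simpa [discreteFunctor_map] using pentagon a.as b.as c.as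
  · intro b
    simpa [discreteFunctor_map] using left_unit b.as
  · intro a
    have := hφ0 a.as
    simp [discreteFunctor_map, this]

instance discreteAddMonoidalFunctorBraided {A B : Type*} [AddCommMonoid A] [AddCommMonoid B]
    (f : A →+ B) : (Discrete.addMonoidalFunctor f).Braided where
  braided _ _ := Subsingleton.elim _ _

lemma braiding_self_eq_unitScalar_of_iso {A B : C} (e : A ≅ B) {c : 𝟙_ C ⟶ 𝟙_ C}
    (h : (β_ B B).hom = unitScalar c _) : (β_ A A).hom = unitScalar c _ := by
  rw [← cancel_mono (e.hom ⊗ₘ e.hom), ← BraidedCategory.braiding_naturality, h,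
    unitScalar_naturality]

lemma exists_isTwistedBraided_int {X Y : C} (α : 𝟙_ C ≅ Y ⊗ X) (D : LeftDualData X) :
    ∃ (F : Discrete ℤ ⥤ C) (_ : F.Monoidal), Nonempty (F.obj ⟨1⟩ ≅ X) ∧
      IsTwistedBraided F (fun a b => unitEndPow (trOf D (𝟙 X)) (a.as * b.as).natAbs) := by
  obtain ⟨F, _, ⟨e⟩⟩ := exists_monoidal_int α
  obtain ⟨hβ, hsq⟩ := braiding_self_eq_trOf α D
  exact ⟨F, _, ⟨e⟩, isTwistedBraided_int F _ (braiding_self_eq_unitScalar_of_iso e hβ) hsq⟩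

lemma exists_isTwistedBraided {n : ℕ} (X Xinv : Fin n → C) (α : ∀ i, 𝟙_ C ≅ Xinv i ⊗ X i)
    (Dd : ∀ i, LeftDualData (X i)) :
    ∃ (F : Discrete (Fin n → ℤ) ⥤ C) (_ : F.Monoidal),
      (∀ i, Nonempty (F.obj ⟨Pi.single i 1⟩ ≅ X i)) ∧
      IsTwistedBraided F (fun a b => (List.ofFn fun i =>
        unitEndPow (trOf (Dd i) (𝟙 (X i))) (a.as i * b.as i).natAbs).prod) := by
  induction n with
  | zero =>
    obtain ⟨F, _, ⟨e⟩⟩ := exists_monoidal_int (λ_ (𝟙_ C)).symm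
    refine ⟨Discrete.addMonoidalFunctor 0 ⋙ F, inferInstance, fun i => i.elim0, ?_⟩
    have hβ : (β_ (𝟙_ C) (𝟙_ C)).hom = unitScalar (𝟙 (𝟙_ C)) _ := by
      rw [unitScalar_id, braiding_tensorUnit_left, ← unitors_inv_equal, Iso.hom_inv_id]
    convert! (isTwistedBraided_int F 1 (braiding_self_eq_unitScalar_of_iso e hβ)
      (one_mul 1)).comp (Discrete.addMonoidalFunctor 0) using 3
  | succ n ih =>
    obtain ⟨F, _, ⟨e⟩, hF⟩ := exists_isTwistedBraided_int (α 0) (Dd 0)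
    obtain ⟨G, _, e', hG⟩ := ih (fun i => X i.succ) (fun i => Xinv i.succ) (fun i => α i.succ)
      (fun i => Dd i.succ)
    let head : (Fin (n + 1) → ℤ) →+ ℤ := Pi.evalAddMonoidHom _ 0
    let tail : (Fin (n + 1) → ℤ) →+ (Fin n → ℤ) :=
      AddMonoidHom.mk' (fun a i => a i.succ) (fun _ _ => rfl)
    refine ⟨(Discrete.addMonoidalFunctor head ⋙ F).prod' (Discrete.addMonoidalFunctor tail ⋙ G) ⋙
      tensor C, inferInstance, fun i => ?_, ?_⟩
    · cases i using Fin.cases with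
      | zero =>
        have hhead : head (Pi.single 0 1) = 1 :=
          Pi.single_eq_same (M := fun _ : Fin (n + 1) => ℤ) 0 1
        have htail : tail (Pi.single 0 1) = 0 := by
          funext j
          exact Pi.single_eq_of_ne (M := fun _ : Fin (n + 1) => ℤ) (Fin.succ_ne_zero j) 1
        exact ⟨((F.mapIso (Discrete.eqToIso hhead) ≪≫ e) ⊗ᵢ
          (G.mapIso (Discrete.eqToIso htail) ≪≫ (Functor.Monoidal.εIso G).symm)) ≪≫ ρ_ _⟩
      | succ j =>
        have hhead : head (Pi.single j.succ 1) = 0 :=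
          Pi.single_eq_of_ne (M := fun _ : Fin (n + 1) => ℤ) (Fin.succ_ne_zero j).symm 1
        have htail : tail (Pi.single j.succ 1) = Pi.single j 1 := by
          funext k
          change Pi.single j.succ 1 k.succ = _
          simp [Pi.single_apply]
        have etail : Discrete.mk (tail (Pi.single j.succ 1)) ≅ ⟨Pi.single j 1⟩ :=
          Discrete.eqToIso htail
        exact ⟨((F.mapIso (Discrete.eqToIso hhead) ≪≫ (Functor.Monoidal.εIso F).symm) ⊗ᵢ
          (G.mapIso etail ≪≫ (e' j).some)) ≪≫ λ_ _⟩
    · convert! (hF.comp (Discrete.addMonoidalFunctor head)).tensor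
        (hG.comp (Discrete.addMonoidalFunctor tail)) using 3 with a b
      rw [List.ofFn_succ, List.prod_cons]
      exact unit_comp_comm _ _

lemma exists_extension {I A : Type*} {T : A → Type*} {f : I → A} (hf : Function.Injective f)
    (t₀ : ∀ a, T a) (v : ∀ i, T (f i)) : ∃ t : ∀ a, T a, ∀ i, t (f i) = v i := by
  classical
  refine ⟨fun a => if h : ∃ i, f i = a then h.choose_spec ▸ v h.choose else t₀ a, fun i => ?_⟩
  have hv (j : I) (h : f j = f i) : (h ▸ v j : T (f i)) = v i := by
    obtain rfl := hf h
    rfl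
  have hi : ∃ j, f j = f i := ⟨i, rfl⟩
  exact (dif_pos hi).trans (hv _ _)

lemma sigma_iso_comp_eqToHom {A : C} {p q : Σ P : C, (A ≅ P)} (h : p = q) :
    p.2.hom ≫ eqToHom (congrArg Sigma.fst h) = q.2.hom := by
  subst h
  simp

lemma eqToHom_tensor {A A' B B' : C} (hA : A = A') (hB : B = B') (h : A ⊗ B = A' ⊗ B') :
    eqToHom h = eqToHom hA ⊗ₘ eqToHom hB := by
  subst hA hB
  simp

lemma single_signs_injective (n : ℕ) : Function.Injective
    (Sum.elim (fun i => Pi.single i 1) (fun i => Pi.single i (-1)) :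
      Fin n ⊕ Fin n → Fin n → ℤ) := by
  rintro (i | i) (j | j) h <;> have h := congrFun h i <;>
    by_cases hij : i = j <;> simp_all

/-- For invertible objects `X₁, …, Xₙ` with chosen inverses `(Xinv i, α i)` and basic
commuters `τ_i = tr(id_{X_i})`, there is a canonical system of tensor powers
`X^a` (`a ∈ ℤⁿ`) and coherence isomorphisms `φ_{a,b} : X^a ⊗ X^b ≅ X^{a+b}` (satisfying the
pentagon and unit conditions and compatible with the chosen `α i`) such that the twist
element `τ_{a,b} = D(T_{a,b})`, where `T_{a,b}` is the conjugate by `φ` of the symmetry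
`t_{a,b} : X^a ⊗ X^b ⟶ X^b ⊗ X^a`, satisfies
`τ_{a,b} = τ_1^{a₁b₁} ⋯ τ_n^{aₙbₙ}`. -/
theorem twist_element_formula {n : ℕ} (X Xinv : Fin n → C)
    (α : ∀ i, 𝟙_ C ≅ Xinv i ⊗ X i) (Dd : ∀ i, LeftDualData (X i)) :
    ∃ (Xpow : (Fin n → ℤ) → C) (ι : 𝟙_ C ≅ Xpow 0)
      (φ : ∀ a b : Fin n → ℤ, Xpow a ⊗ Xpow b ≅ Xpow (a + b))
      (hpos : ∀ i, Xpow (Pi.single i 1) = X i)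
      (hneg : ∀ i, Xpow (Pi.single i (-1)) = Xinv i),
      -- unit conditions
      (∀ a, (Xpow a ◁ ι.hom) ≫ (φ a 0).hom =
        (ρ_ (Xpow a)).hom ≫ eqToHom (congrArg Xpow (add_zero a).symm)) ∧
      (∀ b, (ι.hom ▷ Xpow b) ≫ (φ 0 b).hom =
        (λ_ (Xpow b)).hom ≫ eqToHom (congrArg Xpow (zero_add b).symm)) ∧
      -- pentagon condition
      (∀ a b c, ((φ a b).hom ▷ Xpow c) ≫ (φ (a + b) c).hom ≫
          eqToHom (congrArg Xpow (add_assoc a b c)) =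
        (α_ (Xpow a) (Xpow b) (Xpow c)).hom ≫ (Xpow a ◁ (φ b c).hom) ≫ (φ a (b + c)).hom) ∧
      -- compatibility with the chosen inverses `α i`
      (∀ i, (φ (Pi.single i (-1)) (Pi.single i 1)).hom =
        eqToHom (show Xpow (Pi.single i (-1)) ⊗ Xpow (Pi.single i 1) = Xinv i ⊗ X i by
          rw [hpos i, hneg i]) ≫ (α i).inv ≫ ι.hom ≫
          eqToHom (congrArg Xpow (show (0 : Fin n → ℤ) = Pi.single i (-1) + Pi.single i 1 by
            rw [← Pi.single_add]; norm_num))) ∧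
      -- the formula for the twist element `τ_{a,b} = D(T_{a,b})`
      (∀ (a b : Fin n → ℤ) (V : C) (δ : 𝟙_ C ≅ V ⊗ Xpow (a + b)),
        Dinv δ ((φ a b).inv ≫ (β_ (Xpow a) (Xpow b)).hom ≫ (φ b a).hom ≫
            eqToHom (congrArg Xpow (add_comm b a))) =
          (List.ofFn fun i =>
            unitEndPow (trOf (Dd i) (𝟙 (X i))) (a i * b i).natAbs).prod) := by
  obtain ⟨F, _, e, hF⟩ := exists_isTwistedBraided X Xinv α Dd
  replace e i := (e i).some
  have hsum (i : Fin n) : (Pi.single i (-1) + Pi.single i 1 : Fin n → ℤ) = 0 := by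
    rw [← Pi.single_add]
    simp
  let m (i : Fin n) : F.obj ⟨Pi.single i (-1)⟩ ⊗ F.obj ⟨Pi.single i 1⟩ ≅ 𝟙_ C :=
    Functor.Monoidal.μIso F _ _ ≪≫ F.mapIso (Discrete.eqToIso (hsum i)) ≪≫
      (Functor.Monoidal.εIso F).symm
  have he' (i : Fin n) : ∃ e' : F.obj ⟨Pi.single i (-1)⟩ ≅ Xinv i,
      e'.hom ⊗ₘ (e i).hom = (m i).hom ≫ (α i).hom := by
    refine ⟨(tensorRightFullyFaithful (m i).symm).preimageIso
      (m i ≪≫ α i ≪≫ whiskerLeftIso _ (e i).symm), ?_⟩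
    have h : (tensorRightFullyFaithful (m i).symm).preimage
        (m i ≪≫ α i ≪≫ whiskerLeftIso _ (e i).symm).hom ▷ _ = _ :=
      (tensorRightFullyFaithful (m i).symm).map_preimage _
    rw [MonoidalCategory.tensorHom_def, Functor.FullyFaithful.preimageIso_hom, h]
    simp
  choose e' he' using he'
  obtain ⟨t, ht⟩ := exists_extension (T := fun a => Σ P : C, (F.obj ⟨a⟩ ≅ P))
    (single_signs_injective n) (fun a => ⟨_, Iso.refl _⟩)
    (fun | .inl i => ⟨X i, e i⟩ | .inr i => ⟨Xinv i, e' i⟩)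
  let Xpow (a : Fin n → ℤ) : C := (t a).1
  let E : F ≅ Discrete.functor Xpow := Discrete.natIso fun a => (t a.as).2
  let _ : (Discrete.functor Xpow).Monoidal := Functor.Monoidal.transport E
  have hpos i : Xpow (Pi.single i 1) = X i := congrArg Sigma.fst (ht (.inl i))
  have hneg i : Xpow (Pi.single i (-1)) = Xinv i := congrArg Sigma.fst (ht (.inr i))
  have hE : IsTwistedBraided (Discrete.functor Xpow) _ := hF.of_iso E
  refine ⟨Xpow, Functor.Monoidal.εIso (Discrete.functor Xpow),
    fun a b => Functor.Monoidal.μIso (Discrete.functor Xpow) ⟨a⟩ ⟨b⟩, hpos, hneg,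
    fun a => ?_, fun b => ?_, fun a b c => ?_, fun i => ?_, fun a b V δ => ?_⟩
  · have h := Functor.LaxMonoidal.right_unitality (Discrete.functor Xpow) ⟨a⟩
    rw [discreteFunctor_map, ← Category.assoc] at h
    exact (comp_eqToHom_iff _ _ _).1 h.symm
  · have h := Functor.LaxMonoidal.left_unitality (Discrete.functor Xpow) ⟨b⟩
    rw [discreteFunctor_map, ← Category.assoc] at h
    exact (comp_eqToHom_iff _ _ _).1 h.symm
  · have h := Functor.LaxMonoidal.associativity (Discrete.functor Xpow) ⟨a⟩ ⟨b⟩ ⟨c⟩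
    rw [discreteFunctor_map] at h
    exact h
  · have hp : eqToHom (hpos i) = E.inv.app ⟨Pi.single i 1⟩ ≫ (e i).hom :=
      ((Iso.inv_comp_eq _).2 (sigma_iso_comp_eqToHom (ht (.inl i))).symm).symm
    have hn : eqToHom (hneg i) = E.inv.app ⟨Pi.single i (-1)⟩ ≫ (e' i).hom :=
      ((Iso.inv_comp_eq _).2 (sigma_iso_comp_eqToHom (ht (.inr i))).symm).symm
    rw [eqToHom_tensor (hneg i) (hpos i), hp, hn, ← MonoidalCategory.tensorHom_comp_tensorHom, he']
    have hnat := E.hom.naturality (Discrete.eqToIso (hsum i)).hom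
    rw [discreteFunctor_map] at hnat
    change (E.inv.app _ ⊗ₘ E.inv.app _) ≫ μ F _ _ ≫ E.hom.app _ =
      _ ≫ _ ≫ (ε F ≫ E.hom.app ⟨0⟩) ≫ _
    simp only [m, Iso.trans_hom, Category.assoc, Iso.hom_inv_id_assoc, Functor.mapIso_hom,
      Iso.symm_hom, Functor.Monoidal.εIso_inv, Functor.Monoidal.μIso_hom]
    have hη := Functor.Monoidal.η_ε F
    rw [reassoc_of% hη, reassoc_of% hnat, eqToHom_trans, eqToHom_refl]
    exact congrArg (_ ≫ ·) (congrArg (_ ≫ ·) (Category.comp_id _).symm)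
  · have h := hE ⟨a⟩ ⟨b⟩
    rw [discreteFunctor_map] at h
    refine Eq.trans ?_ (Dinv_unitScalar δ _)
    congr 1
    refine (Iso.inv_comp_eq _).2 (Eq.trans ?_ (unitScalar_naturality _ _).symm)
    have h := h =≫ eqToHom (congrArg Xpow (add_comm b a))
    simp only [Category.assoc] at h
    refine h.trans (congrArg (_ ≫ ·) ?_)
    rw [eqToHom_trans, eqToHom_refl]
    exact Category.comp_id _
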